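/- Let T ∈ C(H) be a densely defined closed right linear normal operator in H = ℓ²(ℕ, ℍ). Then there exists an anti self-adjoint unitary operator J ∈ B(H) such that JT ⊆ TJ, i.e., J(D(T)) ⊆ D(T) and JTx = TJx for all x ∈ D(T). -/

import Mathlib

noncomputable section

open Quaternion Filter Topology

/-- The division ring `ℍ` of real quaternions. -/
abbrev Hq := Quaternion ℝ

/-- The quaternionic Hilbert space `H = ℓ²(ℕ, ℍ)`. -/
abbrev Hsp := lp (fun _ : ℕ => Hq) 2

/-- Right scalar multiplication `x ↦ x · q` on `ℓ²(ℕ, ℍ)` (coordinatewise right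
multiplication by the quaternion `q`). -/
def rsmul (q : Hq) (x : Hsp) : Hsp := MulOpposite.op q • x

/-- The quaternionic inner product `⟨x, y⟩ = ∑ₙ x̄ₙ yₙ`. -/
def qinner (x y : Hsp) : Hq := ∑' n, star (x n) * y n

/-- The set `𝕊` of unit imaginary quaternions. -/
def QS : Set Hq := {q | star q = -q ∧ ‖q‖ = 1}

/-- The slice complex plane `ℂ_m = {α + mβ : α, β ∈ ℝ}`. -/
def sliceC (m : Hq) : Set Hq := {q | ∃ α β : ℝ, q = (α : Hq) + m * (β : Hq)}

/-- The closed upper half slice plane `ℂ_m⁺ = {α + mβ : α ∈ ℝ, β ≥ 0}`. -/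
def sliceCplus (m : Hq) : Set Hq :=
  {q | ∃ α β : ℝ, 0 ≤ β ∧ q = (α : Hq) + m * (β : Hq)}

/-- `T : H → H` is a bounded right linear operator, i.e. `T ∈ B(H)`. -/
def IsBoundedRightLinear (T : Hsp → Hsp) : Prop :=
  (∀ x y, T (x + y) = T x + T y) ∧ (∀ q x, T (rsmul q x) = rsmul q (T x)) ∧
    ∃ M : ℝ, ∀ x, ‖T x‖ ≤ M * ‖x‖

/-- `S` is the adjoint of the (bounded) operator `T`: `⟨y, Tx⟩ = ⟨Sy, x⟩` for all `x, y`. -/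
def AdjointOf (T S : Hsp → Hsp) : Prop := ∀ x y, qinner y (T x) = qinner (S y) x

/-- `T` is anti self-adjoint: `T* = -T`. -/
def IsAntiSelfAdjoint (T : Hsp → Hsp) : Prop := AdjointOf T (fun x => -(T x))

/-- `T` is unitary: `T*T = TT* = I`. -/
def IsUnitaryOp (T : Hsp → Hsp) : Prop :=
  ∃ S, AdjointOf T S ∧ (∀ x, S (T x) = x) ∧ (∀ x, T (S x) = x)

/-- The slice Hilbert space `H₊^{Jm} = {u ∈ H : Ju = um}`. -/
def Hplus (J : Hsp → Hsp) (m : Hq) : Set Hsp := {u | J u = rsmul m u}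

/-- `H₋^{Jm} = {u ∈ H : Ju = -um}`. -/
def Hminus (J : Hsp → Hsp) (m : Hq) : Set Hsp := {u | J u = -(rsmul m u)}

/-- `e` is an orthonormal basis of the (closed subspace given by the) set `S`:
each `e r` lies in `S`, the `e r` are orthonormal, and every `x ∈ S` expands as
`x = ∑ᵣ (e r) ⟨e r, x⟩`. Taking `S = Set.univ` gives orthonormal bases of `H`. -/
def IsONBasisOn (S : Set Hsp) (e : ℕ → Hsp) : Prop :=
  (∀ r, e r ∈ S) ∧ (∀ r s, qinner (e r) (e s) = if r = s then 1 else 0) ∧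
    ∀ x ∈ S, HasSum (fun r => rsmul (qinner (e r) x) (e r)) x

/-- A (possibly unbounded) operator in `H`: a domain together with an assignment of
values (only the values on the domain are relevant). -/
structure QOp where
  dom : Set Hsp
  app : Hsp → Hsp

/-- The operator `T` is right linear: its domain is a right `ℍ`-submodule and `T`
is additive and right `ℍ`-homogeneous on it. -/
def QOp.IsRightLinear (T : QOp) : Prop :=
  (0 ∈ T.dom) ∧
  (∀ x ∈ T.dom, ∀ y ∈ T.dom, x + y ∈ T.dom ∧ T.app (x + y) = T.app x + T.app y) ∧
  (∀ x ∈ T.dom, ∀ q : Hq, rsmul q x ∈ T.dom ∧ T.app (rsmul q x) = rsmul q (T.app x))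

/-- `T` is densely defined. -/
def QOp.IsDenselyDefined (T : QOp) : Prop := Dense T.dom

/-- `T` is a closed operator: its graph is closed in `H × H`. -/
def QOp.IsClosedOp (T : QOp) : Prop :=
  IsClosed {p : Hsp × Hsp | p.1 ∈ T.dom ∧ p.2 = T.app p.1}

/-- `S` is the adjoint `T*` of `T`: the domain of `S` is
`{y : x ↦ ⟨y, Tx⟩ is continuous on D(T)}` and `⟨y, Tx⟩ = ⟨Sy, x⟩` there. -/
def QOp.IsAdjointOf (T S : QOp) : Prop :=
  S.dom = {y | ContinuousOn (fun x => qinner y (T.app x)) T.dom} ∧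
  ∀ y ∈ S.dom, ∀ x ∈ T.dom, qinner y (T.app x) = qinner (S.app y) x

/-- Composition `S ∘ T` of partial operators, with the natural domain. -/
def QOp.comp (S T : QOp) : QOp :=
  ⟨{x ∈ T.dom | T.app x ∈ S.dom}, fun x => S.app (T.app x)⟩

/-- Equality of partial operators: equal domains and equal values on the domain. -/
def QOp.Eq (A B : QOp) : Prop := A.dom = B.dom ∧ ∀ x ∈ A.dom, A.app x = B.app x

/-- `T` is normal: `T*T = TT*` (including equality of the domains). -/
def QOp.IsNormal (T : QOp) : Prop :=
  ∃ S : QOp, T.IsAdjointOf S ∧ QOp.Eq (S.comp T) (T.comp S)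

/-- `T` is compact (as an operator on the subspace `S` of `H`): the image of the
closed unit ball of `S` is relatively compact. -/
def IsCompactOn (T : Hsp → Hsp) (S : Set Hsp) : Prop :=
  IsCompact (closure (T '' (Metric.closedBall 0 1 ∩ S)))

/-- `T` has squared Hilbert–Schmidt norm `v` on the subspace `S`:
`∑ᵣ ‖T eᵣ‖² = v` for some orthonormal basis `e` of `S`. -/
def HasHSNormSqOn (T : Hsp → Hsp) (S : Set Hsp) (v : ℝ) : Prop :=
  ∃ e : ℕ → Hsp, IsONBasisOn S e ∧ HasSum (fun r => ‖T (e r)‖ ^ 2) v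

/-- `T` is diagonal: there are an orthonormal basis `{φᵣ}` of `H` contained in `D(T)`
and quaternions `qᵣ` with `Tφᵣ = φᵣ qᵣ`. -/
def QOp.IsDiagonal (T : QOp) : Prop :=
  ∃ e : ℕ → Hsp, IsONBasisOn Set.univ e ∧ (∀ r, e r ∈ T.dom) ∧
    ∃ q : ℕ → Hq, ∀ r, T.app (e r) = rsmul (q r) (e r)

/-- The operator `Δ_q(N) = N² - N(q + q̄) + I|q|²` for a bounded operator `N`. -/
def sphDeltaB (N : Hsp → Hsp) (q : Hq) : Hsp → Hsp :=
  fun x => N (N x) - rsmul (q + star q) (N x) + rsmul ((normSq q : ℝ) : Hq) x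

/-- `q` lies in the spherical resolvent of the bounded operator `N`. -/
def inSphResolventB (N : Hsp → Hsp) (q : Hq) : Prop :=
  (∀ x, sphDeltaB N q x = 0 → x = 0) ∧
  Dense (Set.range (sphDeltaB N q)) ∧
  ∃ M : ℝ, ∀ x, ‖x‖ ≤ M * ‖sphDeltaB N q x‖

/-- The spherical spectrum of a bounded operator. -/
def sphSpectrumB (N : Hsp → Hsp) : Set Hq := {q | ¬ inSphResolventB N q}

/-- The domain `D(N²)` of the square of a partial operator. -/
def QOp.sqDom (N : QOp) : Set Hsp := {x ∈ N.dom | N.app x ∈ N.dom}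

/-- The map underlying `Δ_q(N) = N² - N(q + q̄) + I|q|²`, defined on `D(N²)`. -/
def sphDeltaU (N : QOp) (q : Hq) : Hsp → Hsp :=
  fun x => N.app (N.app x) - rsmul (q + star q) (N.app x) + rsmul ((normSq q : ℝ) : Hq) x

/-- `q` lies in the spherical resolvent of the operator `N ∈ C(H)`. -/
def inSphResolventU (N : QOp) (q : Hq) : Prop :=
  (∀ x ∈ N.sqDom, sphDeltaU N q x = 0 → x = 0) ∧
  Dense (sphDeltaU N q '' N.sqDom) ∧
  ∃ M : ℝ, ∀ x ∈ N.sqDom, ‖x‖ ≤ M * ‖sphDeltaU N q x‖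

/-- The spherical spectrum of `N ∈ C(H)`. -/
def sphSpectrumU (N : QOp) : Set Hq := {q | ¬ inSphResolventU N q}

/-- The circularization `Ω_K = {α + jβ : α + mβ ∈ K, j ∈ 𝕊}` of `K ⊆ ℂ_m`. -/
def circ (m : Hq) (K : Set Hq) : Set Hq :=
  {p | ∃ α β : ℝ, ∃ j ∈ QS, ((α : Hq) + m * (β : Hq) ∈ K) ∧ p = (α : Hq) + j * (β : Hq)}



section
variable {E : Type*} [NormedAddCommGroup E] [InnerProductSpace ℝ E] [CompleteSpace E]

open ContinuousLinearMap
open scoped InnerProductSpace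

/-- The skew-adjoint contractions commuting with every operator in `M`. -/
def skewContractions (M : Set (E →L[ℝ] E)) : Set (E →L[ℝ] E) :=
  {X | star X = -X ∧ (∀ x, ‖X x‖ ≤ ‖x‖) ∧ ∀ c ∈ M, Commute X c}

/-- The bilinear form of an operator, as a bare function. -/
def operatorForm : (E →L[ℝ] E) →ₗ[ℝ] (E → E → ℝ) where
  toFun X := fun x y => ⟪X x, y⟫_ℝ
  map_add' X Y := by ext x y; simp [inner_add_left]
  map_smul' c X := by ext x y; simp [inner_smul_left]

theorem inner_star_apply (X : E →L[ℝ] E) (x y : E) : ⟪star X x, y⟫_ℝ = ⟪x, X y⟫_ℝ :=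
  adjoint_inner_left X y x

theorem inner_apply_of_star_eq_neg {X : E →L[ℝ] E} (hX : star X = -X) (x y : E) :
    ⟪X x, y⟫_ℝ = -⟪x, X y⟫_ℝ := by
  rw [← inner_star_apply, hX]; simp

omit [CompleteSpace E] in
theorem operatorForm_injective : Function.Injective (operatorForm (E := E)) := by
  intro X Y h
  ext x
  exact ext_inner_right ℝ fun y => congrFun (congrFun h x) y

theorem mem_operatorForm_image_skewContractions (M : Set (E →L[ℝ] E)) (b : E → E → ℝ) :
    b ∈ operatorForm '' skewContractions M ↔
      (∀ x x' y, b (x + x') y = b x y + b x' y) ∧ (∀ (r : ℝ) x y, b (r • x) y = r * b x y) ∧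
      (∀ x y, b x y = -b y x) ∧ (∀ x y, b x y ∈ Set.Icc (-(‖x‖ * ‖y‖)) (‖x‖ * ‖y‖)) ∧
      ∀ c ∈ M, ∀ x y, b (c x) y = b x (star c y) := by
  constructor
  · rintro ⟨X, ⟨hs, hn, hc⟩, rfl⟩
    refine ⟨fun x x' y => by simp [operatorForm, inner_add_left],
      fun r x y => by simp [operatorForm, inner_smul_left],
      fun x y => ?_, fun x y => ?_, fun c h x y => ?_⟩
    · simp only [operatorForm, LinearMap.coe_mk, AddHom.coe_mk]
      rw [inner_apply_of_star_eq_neg hs, real_inner_comm]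
    · have := (abs_real_inner_le_norm (X x) y).trans
        (mul_le_mul_of_nonneg_right (hn x) (norm_nonneg y))
      exact abs_le.1 this
    · have h1 : X (c x) = c (X x) := congrArg (· x) (hc c h).eq
      simp only [operatorForm, LinearMap.coe_mk, AddHom.coe_mk]
      rw [h1, real_inner_comm, ← inner_star_apply, real_inner_comm]
  · rintro ⟨hadd, hsmul, hskew, hbd, hcomm⟩
    have hadd' : ∀ x y y', b x (y + y') = b x y + b x y' := fun x y y' => by
      rw [hskew, hadd, hskew y, hskew y']; ring
    have hsmul' : ∀ (r : ℝ) x y, b x (r • y) = r * b x y := fun r x y => by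
      rw [hskew, hsmul, hskew y]; ring
    let B : E →L[ℝ] E →L[ℝ] ℝ :=
      LinearMap.mkContinuous₂ (LinearMap.mk₂ ℝ b hadd hsmul hadd' hsmul') 1
        (fun x y => by simpa [abs_le] using hbd x y)
    have hB : ∀ x y, ⟪InnerProductSpace.continuousLinearMapOfBilin (𝕜 := ℝ) B x, y⟫_ℝ = b x y :=
      fun x y => InnerProductSpace.continuousLinearMapOfBilin_apply (𝕜 := ℝ) B x y
    set X : E →L[ℝ] E := InnerProductSpace.continuousLinearMapOfBilin (𝕜 := ℝ) B
    refine ⟨X, ⟨?_, fun x => ?_, fun c h => ?_⟩, ?_⟩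
    · ext x
      refine ext_inner_right ℝ fun y => ?_
      rw [inner_star_apply, real_inner_comm, hB, hskew]
      simp [hB]
    · have h1 := (hbd x (X x)).2
      rw [← hB, real_inner_self_eq_norm_sq, sq] at h1
      by_contra! h2
      nlinarith [norm_nonneg x]
    · ext x
      refine ext_inner_right ℝ fun y => ?_
      change ⟪X (c x), y⟫_ℝ = ⟪c (X x), y⟫_ℝ
      rw [hB, hcomm c h, ← hB, real_inner_comm, inner_star_apply, real_inner_comm]
    · ext x y
      exact hB x y

theorem isCompact_operatorForm_image_skewContractions (M : Set (E →L[ℝ] E)) :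
    IsCompact (operatorForm '' skewContractions M) := by
  refine IsCompact.of_isClosed_subset
    (isCompact_univ_pi (s := fun x : E => Set.univ.pi fun y : E =>
      Set.Icc (-(‖x‖ * ‖y‖)) (‖x‖ * ‖y‖)) fun x => isCompact_univ_pi fun y => isCompact_Icc)
    ?_ fun b hb x _ y _ => ((mem_operatorForm_image_skewContractions M b).1 hb).2.2.2.1 x y
  have : operatorForm '' skewContractions M = {b : E → E → ℝ |
      (∀ x x' y, b (x + x') y = b x y + b x' y) ∧ (∀ (r : ℝ) x y, b (r • x) y = r * b x y) ∧
      (∀ x y, b x y = -b y x) ∧ (∀ x y, b x y ∈ Set.Icc (-(‖x‖ * ‖y‖)) (‖x‖ * ‖y‖)) ∧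
      ∀ c ∈ M, ∀ x y, b (c x) y = b x (star c y)} :=
    Set.ext fun b => mem_operatorForm_image_skewContractions M b
  rw [this]
  have hev : ∀ x y : E, Continuous fun b : E → E → ℝ => b x y := fun x y => by fun_prop
  simp only [Set.ofPred_and, Set.ofPred_forall]
  refine .inter ?_ (.inter ?_ (.inter ?_ (.inter ?_ ?_)))
  · exact isClosed_iInter fun x => isClosed_iInter fun x' => isClosed_iInter fun y =>
      isClosed_eq (hev _ _) ((hev _ _).add (hev _ _))
  · exact isClosed_iInter fun r => isClosed_iInter fun x => isClosed_iInter fun y =>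
      isClosed_eq (hev _ _) (continuous_const.mul (hev _ _))
  · exact isClosed_iInter fun x => isClosed_iInter fun y => isClosed_eq (hev _ _) (hev _ _).neg
  · exact isClosed_iInter fun x => isClosed_iInter fun y => isClosed_Icc.preimage (hev x y)
  · exact isClosed_iInter fun c => isClosed_iInter fun _ => isClosed_iInter fun x =>
      isClosed_iInter fun y => isClosed_eq (hev _ _) (hev _ _)

theorem exists_extreme_skewContraction (M : Set (E →L[ℝ] E)) :
    ∃ X ∈ skewContractions M, ∀ Y, X + Y ∈ skewContractions M → X - Y ∈ skewContractions M →
      Y = 0 := by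
  have h0 : (0 : E →L[ℝ] E) ∈ skewContractions M :=
    ⟨by simp, by simp, fun c _ => Commute.zero_left c⟩
  obtain ⟨b, hb⟩ := (isCompact_operatorForm_image_skewContractions M).extremePoints_nonempty
    ⟨_, Set.mem_image_of_mem _ h0⟩
  rw [mem_extremePoints] at hb
  obtain ⟨⟨X, hX, rfl⟩, hext⟩ := hb
  refine ⟨X, hX, fun Y hp hm => ?_⟩
  have := (hext _ (Set.mem_image_of_mem _ hp) _ (Set.mem_image_of_mem _ hm)
    ⟨1 / 2, 1 / 2, by norm_num, by norm_num, by norm_num, by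
      rw [← map_smul, ← map_smul, ← map_add]; congr 1; module⟩).1
  simpa using operatorForm_injective this

theorem mem_skewContractions_of_norm_sq {M : Set (E →L[ℝ] E)} {X : E →L[ℝ] E} (hs : star X = -X)
    (hc : ∀ c ∈ M, Commute X c) (h : ∀ x, ‖X x‖ ^ 2 ≤ ‖x‖ ^ 2) : X ∈ skewContractions M :=
  ⟨hs, fun x => (sq_le_sq₀ (norm_nonneg _) (norm_nonneg _)).1 (h x), hc⟩


theorem commute_starProjection {W : Submodule ℝ E} [W.HasOrthogonalProjection] {a : E →L[ℝ] E}
    (h : ∀ x ∈ W, a x ∈ W) (h' : ∀ x ∈ W, star a x ∈ W) : Commute W.starProjection a := by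
  ext x
  refine Submodule.eq_starProjection_of_mem_of_inner_eq_zero
    (h _ (Submodule.starProjection_apply_mem W x)) fun w hw => ?_
  change ⟪a x - a (W.starProjection x), w⟫_ℝ = 0
  rw [← map_sub, real_inner_comm, ← inner_star_apply, real_inner_comm]
  exact Submodule.starProjection_inner_eq_zero x _ (h' w hw)

theorem star_one_add_mul_self {X : E →L[ℝ] E} (hs : star X = -X) :
    star (1 + X * X) = 1 + X * X := by
  simp [hs]

theorem inner_one_add_mul_self {X : E →L[ℝ] E} (hs : star X = -X) (x : E) :
    ⟪(1 + X * X) x, x⟫_ℝ = ‖x‖ ^ 2 - ‖X x‖ ^ 2 := by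
  change ⟪x + X (X x), x⟫_ℝ = _
  rw [inner_add_left, inner_apply_of_star_eq_neg hs, real_inner_self_eq_norm_sq,
    real_inner_self_eq_norm_sq]
  ring

section Extreme

variable {M : Set (E →L[ℝ] E)} {X : E →L[ℝ] E} (hX : X ∈ skewContractions M)
  (hext : ∀ Y, X + Y ∈ skewContractions M → X - Y ∈ skewContractions M → Y = 0)

include hX hext

theorem extreme_mul_one_add_mul_self_eq_zero : X * (1 + X * X) = 0 := by
  obtain ⟨hs, hn, hc⟩ := hX
  have hps := star_one_add_mul_self hs
  have hpX := inner_one_add_mul_self hs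
  have hXp : Commute X (1 + X * X) := (Commute.one_right X).add_right
    ((Commute.refl X).mul_right (Commute.refl X))
  have hpc : ∀ c ∈ M, Commute (1 + X * X) c := fun c h =>
    (Commute.one_left c).add_left ((hc c h).mul_left (hc c h))
  have hpdef : ∀ x, (1 + X * X) x = x + X (X x) := fun x => rfl
  set p := 1 + X * X with hp
  have hpos : ∀ x, 0 ≤ ⟪p x, x⟫_ℝ := fun x => by
    rw [hpX]
    have := (sq_le_sq₀ (norm_nonneg _) (norm_nonneg _)).2 (hn x)
    linarith
  have hle : ∀ x, ‖p x‖ ^ 2 ≤ ⟪p x, x⟫_ℝ := fun x => by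
    have h1 := hpos (X x)
    have h2 : p (X x) = X (p x) := congrArg (· x) hXp.eq.symm
    rw [h2, inner_apply_of_star_eq_neg hs] at h1
    have h3 : X (X x) = p x - x := by rw [hpdef]; abel
    rw [h3, inner_sub_right, real_inner_self_eq_norm_sq] at h1
    linarith
  have key : ∀ t : ℝ, (∀ x, 0 ≤ (1 - 2 * t) * ⟪p x, x⟫_ℝ + (2 * t - t ^ 2) * ‖p x‖ ^ 2
      + t ^ 2 * ⟪p (p x), p x⟫_ℝ) → X + t • (X * p) ∈ skewContractions M := by
    intro t ht
    refine mem_skewContractions_of_norm_sq ?_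
      (fun c h => (hc c h).add_left (((hc c h).mul_left (hpc c h)).smul_left t)) fun x => ?_
    · simp only [star_add, StarModule.star_smul, star_mul, hs, hps, star_trivial, neg_mul, hXp.eq]
      module
    · have h1 : (X + t • (X * p)) x = X (x + t • p x) := by
        simp
      have h2 := hpX (x + t • p x)
      have h3 := ht x
      have h4 : ⟪p (p x), x⟫_ℝ = ‖p x‖ ^ 2 := by
        rw [← real_inner_self_eq_norm_sq, ← hps, inner_star_apply, hps]
      have h5 : ‖x + t • p x‖ ^ 2 = ‖x‖ ^ 2 + 2 * t * ⟪p x, x⟫_ℝ + t ^ 2 * ‖p x‖ ^ 2 := by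
        rw [norm_add_sq_real, inner_smul_right, norm_smul, real_inner_comm, mul_pow,
          Real.norm_eq_abs, sq_abs]
        ring
      have h6 : ⟪p (x + t • p x), x + t • p x⟫_ℝ =
          ⟪p x, x⟫_ℝ + 2 * t * ‖p x‖ ^ 2 + t ^ 2 * ⟪p (p x), p x⟫_ℝ := by
        simp only [map_add, map_smul, inner_add_left, inner_add_right, inner_smul_left,
          inner_smul_right, h4, real_inner_self_eq_norm_sq]
        simp
        ring
      rw [h1]
      rw [h5, h6] at h2
      linarith
  have h0 := hext ((1 / 2 : ℝ) • (X * p)) (key _ fun x => ?_) ?_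
  · simpa using h0
  · have := hpos (p x)
    nlinarith [sq_nonneg ‖p x‖]
  · rw [sub_eq_add_neg, ← neg_smul]
    refine key _ fun x => ?_
    nlinarith [sq_nonneg ‖p x‖, hle x, hpos (p x)]

theorem extreme_compression_eq_zero {Y : E →L[ℝ] E} (hY : star Y = -Y)
    (hYM : ∀ c ∈ M, Commute Y c) : (1 + X * X) * Y * (1 + X * X) = 0 := by
  have hXp := extreme_mul_one_add_mul_self_eq_zero hX hext
  obtain ⟨hs, hn, hc⟩ := hX
  have hps := star_one_add_mul_self hs
  have hpX := inner_one_add_mul_self hs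
  have hpc : ∀ c ∈ M, Commute (1 + X * X) c := fun c h =>
    (Commute.one_left c).add_left ((hc c h).mul_left (hc c h))
  have hpp : (1 + X * X) * (1 + X * X) = 1 + X * X := by
    rw [add_mul, mul_assoc, hXp, mul_zero, one_mul, add_zero]
  have hpX0 : (1 + X * X) * X = 0 := by
    rw [← hXp]; noncomm_ring
  set p := 1 + X * X with hp
  have hpn : ∀ x, ⟪p x, x⟫_ℝ = ‖p x‖ ^ 2 := fun x => by
    rw [← real_inner_self_eq_norm_sq]
    nth_rewrite 3 [← hps]
    rw [real_inner_comm (star p x), inner_star_apply]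
    change _ = ⟪x, (p * p) x⟫_ℝ
    rw [hpp, real_inner_comm]
  have hZs : star (p * Y * p) = -(p * Y * p) := by
    simp only [star_mul, hps, hY]; noncomm_ring
  have hZM : ∀ c ∈ M, Commute (p * Y * p) c := fun c h =>
    ((hpc c h).mul_left (hYM c h)).mul_left (hpc c h)
  obtain ⟨r, hr, hrY⟩ : ∃ r : ℝ, 0 < r ∧ ∀ x, ‖r • (p * Y * p) x‖ ≤ ‖p x‖ := by
    refine ⟨(‖p * Y‖ + 1)⁻¹, by positivity, fun x => ?_⟩
    rw [norm_smul, Real.norm_of_nonneg (by positivity), inv_mul_le_iff₀ (by positivity)]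
    refine ((p * Y).le_opNorm (p x)).trans ?_
    gcongr
    linarith
  have key : ∀ t : ℝ, |t| = r → X + t • (p * Y * p) ∈ skewContractions M := by
    intro t ht
    refine mem_skewContractions_of_norm_sq ?_
      (fun c h => (hc c h).add_left ((hZM c h).smul_left t)) fun x => ?_
    · rw [star_add, StarModule.star_smul, hZs, hs, star_trivial]; module
    · have h1 : ⟪X x, (p * Y * p) x⟫_ℝ = 0 := by
        change ⟪X x, p (Y (p x))⟫_ℝ = 0
        rw [← inner_star_apply, hps]
        change ⟪(p * X) x, _⟫_ℝ = 0
        rw [hpX0]; simp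
      have h2 : ‖t • (p * Y * p) x‖ ^ 2 ≤ ‖p x‖ ^ 2 := by
        refine (sq_le_sq₀ (norm_nonneg _) (norm_nonneg _)).2 ((le_of_eq ?_).trans (hrY x))
        rw [norm_smul, norm_smul, Real.norm_eq_abs, ht, Real.norm_of_nonneg hr.le]
      have h3 := hpX x
      rw [hpn] at h3
      change ‖X x + t • (p * Y * p) x‖ ^ 2 ≤ _
      rw [norm_add_sq_real, inner_smul_right, h1]
      linarith
  have h0 := hext (r • (p * Y * p)) (key r (abs_of_pos hr)) (by
    rw [sub_eq_add_neg, ← neg_smul]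
    exact key (-r) (by rw [abs_neg, abs_of_pos hr]))
  exact (smul_eq_zero.1 h0).resolve_left hr.ne'

end Extreme

/-- A commutative star algebra of operators on a real Hilbert space, all commuting with an
action of the quaternion units by skew-adjoint operators `I` and `J`, commutes with an
anti-self-adjoint unitary that also commutes with `I` and `J`. -/
theorem exists_skew_unitary_commuting (S : StarSubalgebra ℝ (E →L[ℝ] E))
    (hS : ∀ a ∈ S, ∀ b ∈ S, Commute a b) {I J : E →L[ℝ] E} (hI : star I = -I) (hJ : star J = -J)
    (hII : I * I = -1) (hJJ : J * J = -1) (hIJ : I * J = -(J * I))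
    (hSI : ∀ a ∈ S, Commute a I) (hSJ : ∀ a ∈ S, Commute a J) :
    ∃ X : E →L[ℝ] E, star X = -X ∧ X * X = -1 ∧ Commute X I ∧ Commute X J ∧
      ∀ a ∈ S, Commute X a := by
  obtain ⟨X, hX, hext⟩ := exists_extreme_skewContraction ((S : Set (E →L[ℝ] E)) ∪ {I, J})
  have hXI : Commute X I := hX.2.2 I (by simp)
  have hXJ : Commute X J := hX.2.2 J (by simp)
  have hXS : ∀ a ∈ S, Commute X a := fun a ha => hX.2.2 a (Or.inl ha)
  refine ⟨X, hX.1, ?_, hXI, hXJ, hXS⟩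
  have hcompr : ∀ Y : E →L[ℝ] E, star Y = -Y → Commute Y I → Commute Y J →
      (∀ a ∈ S, Commute Y a) → (1 + X * X) * Y * (1 + X * X) = 0 := by
    intro Y hY hYI hYJ hYS
    refine extreme_compression_eq_zero hX hext hY ?_
    rintro c (h | rfl | rfl)
    exacts [hYS c h, hYI, hYJ]
  have hpI : Commute (1 + X * X) I := (Commute.one_left I).add_left (hXI.mul_left hXI)
  have hpS : ∀ a ∈ S, Commute (1 + X * X) a := fun a ha =>
    (Commute.one_left a).add_left ((hXS a ha).mul_left (hXS a ha))
  have hpp : (1 + X * X) * (1 + X * X) = 1 + X * X := by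
    rw [add_mul, mul_assoc, extreme_mul_one_add_mul_self_eq_zero hX hext, mul_zero, one_mul,
      add_zero]
  have hps := star_one_add_mul_self hX.1
  set p := 1 + X * X with hp
  suffices p = 0 by rw [eq_neg_iff_add_eq_zero, add_comm]; exact this
  ext w
  set v := p w with hv
  have hpv : p v = v := congrArg (· w) hpp
  change v = 0
  have hstar : ∀ a ∈ S, star a v = a v := by
    intro a ha
    have hsa : star a ∈ S := star_mem ha
    have hsub : star a - a ∈ S := sub_mem hsa ha
    have h1 := hcompr (star a - a) (by simp) (hSI _ hsub) (hSJ _ hsub) fun b hb => hS _ hsub b hb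
    have h2 : (p * (star a - a) * p) v = (star a - a) v := by
      rw [(hpS _ hsub).eq, mul_assoc, hpp]
      change (star a - a) (p v) = _
      rw [hpv]
    rw [h1] at h2
    exact sub_eq_zero.1 h2.symm
  let W : Submodule ℝ E :=
    ((Subalgebra.toSubmodule S.toSubalgebra).map
      (ContinuousLinearMap.apply ℝ E v).toLinearMap).topologicalClosure
  have hWmem : ∀ a ∈ S, a v ∈ W := fun a ha =>
    Submodule.le_topologicalClosure _ ⟨a, ha, rfl⟩
  have hWind : ∀ {F : Set E}, IsClosed F → (∀ a ∈ S, a v ∈ F) → ∀ x ∈ W, x ∈ F := by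
    intro F hF h x hx
    refine closure_minimal ?_ hF hx
    rintro _ ⟨a, ha, rfl⟩
    exact h a ha
  have hWcl : IsClosed (W : Set E) := Submodule.isClosed_topologicalClosure _
  have : CompleteSpace W := hWcl.completeSpace_coe
  have hWinv : ∀ a ∈ S, ∀ x ∈ W, a x ∈ W := fun a ha =>
    hWind (hWcl.preimage a.continuous) fun b hb => hWmem (a * b) (mul_mem ha hb)
  have hπS : ∀ a ∈ S, Commute W.starProjection a := fun a ha =>
    commute_starProjection (hWinv a ha) (hWinv _ (star_mem ha))
  have hπv : W.starProjection v = v :=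
    Submodule.starProjection_eq_self_iff.2 (hWmem 1 (one_mem S))
  have hπs : star W.starProjection = W.starProjection := by
    ext x
    exact ext_inner_right ℝ fun y => by
      rw [inner_star_apply, Submodule.inner_starProjection_left_eq_right]
  have hπU : ∀ U : E →L[ℝ] E, star U = -U → (∀ a ∈ S, Commute a U) →
      W.starProjection (U v) = 0 := by
    intro U hU hUS
    refine Submodule.eq_starProjection_of_mem_of_inner_eq_zero (zero_mem W) ?_
    refine hWind (F := {x | ⟪U v - 0, x⟫_ℝ = 0})
      (isClosed_eq (by fun_prop) continuous_const) fun a ha => ?_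
    change ⟪U v - 0, a v⟫_ℝ = 0
    have h1 : ⟪U v, a v⟫_ℝ = -⟪v, (U * a) v⟫_ℝ := inner_apply_of_star_eq_neg hU v (a v)
    have h2 : ⟪v, (a * U) v⟫_ℝ = ⟪U v, a v⟫_ℝ := by
      change ⟪v, a (U v)⟫_ℝ = _
      rw [← inner_star_apply, hstar a ha, real_inner_comm]
    rw [← (hUS a ha).eq, h2] at h1
    rw [sub_zero]
    linarith
  have hIJ' : ∀ Z, I * (J * Z) = -(J * (I * Z)) := fun Z => by
    rw [← mul_assoc, hIJ, neg_mul, mul_assoc]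
  have hII' : ∀ Z, I * (I * Z) = -Z := fun Z => by rw [← mul_assoc, hII, neg_one_mul]
  have hJJ' : ∀ Z, J * (J * Z) = -Z := fun Z => by rw [← mul_assoc, hJJ, neg_one_mul]
  have hKs : star (J * I) = -(J * I) := by simp [hI, hJ, hIJ]
  have hKS : ∀ a ∈ S, Commute a (J * I) := fun a ha => (hSJ a ha).mul_right (hSI a ha)
  set π := W.starProjection
  have h0 := hcompr (I * π + π * I - (J * I) * π * J + J * π * (J * I)) ?_ ?_ ?_ ?_
  · have h1 := congrArg (· v) h0
    change p ((I (π (p v)) + π (I (p v)) - (J * I) (π (J (p v))) + J (π ((J * I) (p v))))) = 0 at h1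
    rw [hpv, hπv, hπU I hI hSI, hπU J hJ hSJ, hπU _ hKs hKS] at h1
    simp only [map_zero, add_zero, sub_zero] at h1
    have h2 : p (I v) = I (p v) := congrArg (· v) hpI.eq
    rw [h2, hpv] at h1
    have h3 : I (I v) = -v := congrArg (· v) hII
    rw [h1, map_zero] at h3
    exact neg_eq_zero.1 h3.symm
  · simp only [star_add, star_sub, star_mul, hI, hJ, hπs, mul_assoc, neg_mul, mul_neg, neg_neg, hIJ]
    abel
  · simp only [Commute, SemiconjBy, add_mul, mul_add, sub_mul, mul_sub, mul_assoc, mul_neg, hII,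
      hII', hIJ', mul_one, neg_neg]
    abel
  · simp only [Commute, SemiconjBy, add_mul, mul_add, sub_mul, mul_sub, mul_assoc, mul_neg, hJJ,
      hIJ, hJJ', mul_one, neg_neg]
    abel
  · intro a ha
    have h1 := (hSI a ha).symm
    have h2 := (hSJ a ha).symm
    have h3 := (hKS a ha).symm
    have h4 := hπS a ha
    exact (((h1.mul_left h4).add_left (h4.mul_left h1)).sub_left
      ((h3.mul_left h4).mul_left h2)).add_left ((h2.mul_left h4).mul_left h3)

end

section
open scoped InnerProductSpace

theorem norm_rsmul_le (q : Hq) (x : Hsp) : ‖rsmul q x‖ ≤ ‖q‖ * ‖x‖ :=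
  norm_smul_le (MulOpposite.op q) x

/-- Right multiplication by a quaternion as a continuous real-linear operator. -/
def rightMul (q : Hq) : Hsp →L[ℝ] Hsp :=
  LinearMap.mkContinuous
    { toFun := rsmul q
      map_add' := fun x y => smul_add _ x y
      map_smul' := fun r x => smul_comm _ r x } ‖q‖ (norm_rsmul_le q)

@[simp]
theorem rightMul_apply (q : Hq) (x : Hsp) : rightMul q x = rsmul q x := rfl

@[simp]
theorem coe_rsmul (q : Hq) (x : Hsp) (n : ℕ) : rsmul q x n = x n * q := rfl

theorem rsmul_coe (r : ℝ) (x : Hsp) : rsmul (r : Hq) x = r • x := by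
  ext1; funext n
  simp [← Quaternion.coe_mul_eq_smul, Quaternion.coe_commutes]

theorem rsmul_rsmul (p q : Hq) (x : Hsp) : rsmul p (rsmul q x) = rsmul (q * p) x := by
  ext1; funext n
  simp [mul_assoc]

theorem summable_star_mul (x y : Hsp) : Summable fun n => star (x n) * y n := by
  refine Summable.of_norm_bounded
    (g := fun n => ‖x n‖ * ‖y n‖) ?_ fun n => by simp
  have hx := (lp.memℓp x).summable (by norm_num)
  have hy := (lp.memℓp y).summable (by norm_num)
  refine Summable.of_nonneg_of_le (fun n => by positivity) (fun n => ?_) (hx.add hy)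
  have := sq_nonneg (‖x n‖ - ‖y n‖)
  simp only [ENNReal.toReal_ofNat, Real.rpow_ofNat]
  nlinarith [norm_nonneg (x n), norm_nonneg (y n)]

theorem re_qinner (x y : Hsp) : (qinner x y).re = ⟪x, y⟫_ℝ := by
  have h := (summable_star_mul x y).hasSum.map
    ({ toFun := fun q => q.re, map_zero' := rfl, map_add' := fun _ _ => rfl } : Hq →+ ℝ)
    Quaternion.continuous_re
  have heq : (fun n => ⟪x n, y n⟫_ℝ) = (fun q : Hq => q.re) ∘ fun n => star (x n) * y n := by
    funext n
    simp [Quaternion.inner_def]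
  have h' := lp.hasSum_inner (𝕜 := ℝ) x y
  rw [heq] at h'
  exact h.unique h'

theorem qinner_rsmul_right (x y : Hsp) (q : Hq) : qinner x (rsmul q y) = qinner x y * q := by
  simp only [qinner, coe_rsmul, ← mul_assoc, tsum_mul_right]

theorem qinner_rsmul_left (x y : Hsp) (q : Hq) :
    qinner (rsmul q x) y = star q * qinner x y := by
  simp only [qinner, coe_rsmul, star_mul, mul_assoc, tsum_mul_left]

theorem inner_rsmul_left (x y : Hsp) (q : Hq) :
    ⟪rsmul q x, y⟫_ℝ = ⟪x, rsmul (star q) y⟫_ℝ := by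
  rw [← re_qinner, ← re_qinner, qinner_rsmul_left, qinner_rsmul_right]
  simp
  ring

theorem star_rightMul (q : Hq) : star (rightMul q) = rightMul (star q) := by
  ext1 x
  exact ext_inner_right ℝ fun y => by
    rw [inner_star_apply, rightMul_apply, rightMul_apply, inner_rsmul_left, star_star]

theorem rightMul_mul (p q : Hq) : rightMul p * rightMul q = rightMul (q * p) := by
  ext1 x
  exact rsmul_rsmul p q x

theorem qinner_eq_of_inner_rsmul {x y x' y' : Hsp}
    (h : ∀ q, ⟪x, rsmul q y⟫_ℝ = ⟪x', rsmul q y'⟫_ℝ) : qinner x y = qinner x' y' := by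
  simp only [← re_qinner, qinner_rsmul_right] at h
  rw [← sub_eq_zero, ← Quaternion.normSq_eq_zero]
  have := h (star (qinner x y - qinner x' y'))
  rw [← sub_eq_zero, ← Quaternion.re_sub, ← sub_mul, Quaternion.self_mul_star] at this
  exact this

/-- The quaternion unit `i`. -/
@[simps]
def unitI : Hq := ⟨0, 1, 0, 0⟩

/-- The quaternion unit `j`. -/
@[simps]
def unitJ : Hq := ⟨0, 0, 1, 0⟩

theorem quaternion_eq (q : Hq) :
    q = (q.re : Hq) + unitI * (q.imI : Hq) + unitJ * (q.imJ : Hq) +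
      unitI * unitJ * (q.imK : Hq) := by
  ext <;> simp

theorem rightMul_add (p q : Hq) : rightMul (p + q) = rightMul p + rightMul q := by
  ext1 x
  ext1; funext n
  simp [mul_add]

theorem rightMul_coe (r : ℝ) : rightMul (r : Hq) = r • 1 := by
  ext1 x
  exact rsmul_coe r x

theorem commute_rightMul {X : Hsp →L[ℝ] Hsp} (hI : Commute X (rightMul unitI))
    (hJ : Commute X (rightMul unitJ)) (q : Hq) : Commute X (rightMul q) := by
  have hr : ∀ r : ℝ, Commute X (rightMul (r : Hq)) := fun r => by
    rw [rightMul_coe]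
    exact (Commute.one_right X).smul_right r
  rw [quaternion_eq q]
  simp only [rightMul_add, ← rightMul_mul]
  exact (((hr _).add_right ((hr _).mul_right hI)).add_right ((hr _).mul_right hJ)).add_right
    ((hr _).mul_right (hJ.mul_right hI))


theorem QOp.IsAdjointOf.inner_app {T S : QOp} (hS : T.IsAdjointOf S) {x y : Hsp}
    (hx : x ∈ T.dom) (hy : y ∈ S.dom) : ⟪y, T.app x⟫_ℝ = ⟪S.app y, x⟫_ℝ := by
  rw [← re_qinner, ← re_qinner, hS.2 y hy x hx]

theorem norm_qinner_le (x y : Hsp) : ‖qinner x y‖ ≤ ‖x‖ * ‖y‖ := by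
  have h : ⟪rsmul (qinner x y) x, y⟫_ℝ = ‖qinner x y‖ ^ 2 := by
    rw [← re_qinner, qinner_rsmul_left, Quaternion.star_mul_self, Quaternion.re_coe,
      Quaternion.normSq_eq_norm_mul_self, sq]
  have h1 := (real_inner_le_norm _ _).trans
    (mul_le_mul_of_nonneg_right (norm_rsmul_le (qinner x y) x) (norm_nonneg y))
  rw [h] at h1
  by_contra! h2
  nlinarith [norm_nonneg (qinner x y), mul_nonneg (norm_nonneg x) (norm_nonneg y)]

theorem continuous_qinner (a : Hsp) : Continuous fun x => qinner a x := by
  have hadd : ∀ x y, qinner a (x + y) = qinner a x + qinner a y := fun x y => by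
    simp only [qinner, lp.coeFn_add, Pi.add_apply, mul_add]
    exact (summable_star_mul a x).tsum_add (summable_star_mul a y)
  refine (AddMonoidHomClass.lipschitz_of_bound
    ({ toFun := fun x => qinner a x, map_zero' := by simp [qinner], map_add' := hadd } :
      Hsp →+ Hq) ‖a‖ fun x => norm_qinner_le a x).continuous

section Adjoint

variable {T S : QOp} (hlin : T.IsRightLinear) (hdense : T.IsDenselyDefined)
  (hS : T.IsAdjointOf S)

include hlin hdense hS

theorem QOp.IsAdjointOf.mem_and_app_eq {a y : Hsp}
    (h : ∀ x ∈ T.dom, ⟪y, T.app x⟫_ℝ = ⟪a, x⟫_ℝ) : y ∈ S.dom ∧ S.app y = a := by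
  have hq : ∀ x ∈ T.dom, qinner y (T.app x) = qinner a x := fun x hx =>
    qinner_eq_of_inner_rsmul fun q => by
      rw [← (hlin.2.2 x hx q).2]
      exact h _ (hlin.2.2 x hx q).1
  have hy : y ∈ S.dom := by
    rw [hS.1]
    exact (continuous_qinner a).continuousOn.congr hq
  refine ⟨hy, hdense.eq_of_inner_left ℝ fun x hx => ?_⟩
  rw [← hS.inner_app hx hy, h x hx]

theorem QOp.IsAdjointOf.app_rsmul {y : Hsp} (hy : y ∈ S.dom) (q : Hq) :
    rsmul q y ∈ S.dom ∧ S.app (rsmul q y) = rsmul q (S.app y) := by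
  refine hS.mem_and_app_eq hlin hdense fun x hx => ?_
  rw [inner_rsmul_left, inner_rsmul_left, ← (hlin.2.2 x hx _).2,
    hS.inner_app (hlin.2.2 x hx _).1 hy]

end Adjoint

theorem QOp.IsRightLinear.app_sub {T : QOp} (hlin : T.IsRightLinear) {x y : Hsp}
    (hx : x ∈ T.dom) (hy : y ∈ T.dom) : x - y ∈ T.dom ∧ T.app (x - y) = T.app x - T.app y := by
  have h := hlin.2.2 y hy ((-1 : ℝ) : Hq)
  rw [rsmul_coe, rsmul_coe, neg_one_smul, neg_one_smul] at h
  have h' := hlin.2.1 x hx _ h.1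
  rwa [h.2, ← sub_eq_add_neg, ← sub_eq_add_neg] at h'

/-- Injectivity of `1 + T*T`. -/
theorem QOp.IsAdjointOf.eq_of_add_eq {T S : QOp} (hlin : T.IsRightLinear) (hS : T.IsAdjointOf S)
    {x y : Hsp} (hx : x ∈ T.dom) (hTx : T.app x ∈ S.dom) (hy : y ∈ T.dom)
    (hTy : T.app y ∈ S.dom) (h : x + S.app (T.app x) = y + S.app (T.app y)) : x = y := by
  have hxy := hlin.app_sub hx hy
  have h1 := hS.inner_app hxy.1 hTx
  have h2 := hS.inner_app hxy.1 hTy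
  have h3 : S.app (T.app x) - S.app (T.app y) = -(x - y) := by
    rw [← sub_eq_zero] at h ⊢
    rw [← h]; abel
  have h4 : ⟪T.app x - T.app y, T.app (x - y)⟫_ℝ = ⟪-(x - y), x - y⟫_ℝ := by
    rw [inner_sub_left, h1, h2, ← inner_sub_left, h3]
  rw [hxy.2, inner_neg_left] at h4
  have h5 := real_inner_self_nonneg (x := T.app x - T.app y)
  have h6 := real_inner_self_nonneg (x := x - y)
  exact sub_eq_zero.1 (inner_self_eq_zero (𝕜 := ℝ).1 (le_antisymm (by linarith) h6))

/-- The graph of a right linear operator, as a real subspace of the Hilbert sum. -/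
def QOp.graph (T : QOp) (hlin : T.IsRightLinear) : Submodule ℝ (WithLp 2 (Hsp × Hsp)) where
  carrier := {p | p.fst ∈ T.dom ∧ p.snd = T.app p.fst}
  zero_mem' := by
    have h := hlin.2.2 0 hlin.1 0
    have h0 : ∀ x : Hsp, rsmul 0 x = 0 := fun x => by simpa using rsmul_coe 0 x
    rw [h0, h0] at h
    exact ⟨h.1, h.2.symm⟩
  add_mem' := by
    rintro p r ⟨hp, hp'⟩ ⟨hr, hr'⟩
    have h := hlin.2.1 _ hp _ hr
    refine ⟨h.1, ?_⟩
    change p.snd + r.snd = T.app (p.fst + r.fst)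
    rw [h.2, hp', hr']
  smul_mem' := by
    rintro c p ⟨hp, hp'⟩
    have h := hlin.2.2 _ hp (c : Hq)
    rw [rsmul_coe, rsmul_coe] at h
    refine ⟨h.1, ?_⟩
    change c • p.snd = T.app (c • p.fst)
    rw [h.2, hp']

/-- For normal `T`, with `Z = (1 + T*T)⁻¹` and `C = TZ`, the matrix `(Z, C*; C, 1 - Z)` is the
orthogonal projection onto the graph of `T`. -/
theorem QOp.IsNormal.exists_graph_projection {T : QOp} (hlin : T.IsRightLinear)
    (hdense : T.IsDenselyDefined) (hclosed : T.IsClosedOp) (hnormal : T.IsNormal) :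
    ∃ Z C : Hsp →L[ℝ] Hsp, star Z = Z ∧ Commute Z C ∧ Commute C (star C) ∧
      (∀ q, Commute Z (rightMul q)) ∧ (∀ q, Commute C (rightMul q)) ∧
      (∀ u w, Z u + star C w ∈ T.dom ∧ T.app (Z u + star C w) = C u + (w - Z w)) ∧
      ∀ x ∈ T.dom, Z x + star C (T.app x) = x ∧ C x = Z (T.app x) := by
  obtain ⟨S, hS, hdom, happ⟩ := hnormal
  let e := WithLp.prodContinuousLinearEquiv 2 ℝ Hsp Hsp
  let G := T.graph hlin
  have hG : IsClosed (G : Set (WithLp 2 (Hsp × Hsp))) := hclosed.preimage e.continuous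
  have : CompleteSpace G := hG.completeSpace_coe
  let P : Hsp × Hsp →L[ℝ] Hsp × Hsp :=
    e.toContinuousLinearMap ∘L G.starProjection ∘L e.symm.toContinuousLinearMap
  have hPG : ∀ p, (P p).1 ∈ T.dom ∧ (P p).2 = T.app (P p).1 := fun p =>
    Submodule.starProjection_apply_mem G (e.symm p)
  have hPself : ∀ x ∈ T.dom, P (x, T.app x) = (x, T.app x) := fun x hx => by
    have h : G.starProjection (e.symm (x, T.app x)) = e.symm (x, T.app x) :=
      Submodule.starProjection_eq_self_iff.2 ⟨hx, rfl⟩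
    change e (G.starProjection (e.symm (x, T.app x))) = _
    rw [h, e.apply_symm_apply]
  have hPorth : ∀ p : Hsp × Hsp, ∀ x ∈ T.dom,
      ⟪p.1 - (P p).1, x⟫_ℝ + ⟪p.2 - (P p).2, T.app x⟫_ℝ = 0 := fun p x hx =>
    Submodule.starProjection_inner_eq_zero (K := G) (e.symm p) (e.symm (x, T.app x)) ⟨hx, rfl⟩
  have hPsymm : ∀ p r : Hsp × Hsp,
      ⟪(P p).1, r.1⟫_ℝ + ⟪(P p).2, r.2⟫_ℝ = ⟪p.1, (P r).1⟫_ℝ + ⟪p.2, (P r).2⟫_ℝ := fun p r =>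
    Submodule.inner_starProjection_left_eq_right G (e.symm p) (e.symm r)
  let Z : Hsp →L[ℝ] Hsp := .fst ℝ Hsp Hsp ∘L P ∘L .inl ℝ Hsp Hsp
  let C : Hsp →L[ℝ] Hsp := .snd ℝ Hsp Hsp ∘L P ∘L .inl ℝ Hsp Hsp
  let D : Hsp →L[ℝ] Hsp := .fst ℝ Hsp Hsp ∘L P ∘L .inr ℝ Hsp Hsp
  let F : Hsp →L[ℝ] Hsp := .snd ℝ Hsp Hsp ∘L P ∘L .inr ℝ Hsp Hsp
  have hPadd : ∀ u w, P (u, w) = (Z u + D w, C u + F w) := fun u w => by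
    have h : (u, w) = ((u, 0) : Hsp × Hsp) + (0, w) := by simp
    rw [h, map_add]
    rfl
  have hZ : star Z = Z := by
    ext1 x
    refine ext_inner_right ℝ fun y => ?_
    rw [inner_star_apply]
    have h := hPsymm (x, 0) (y, 0)
    simp only [inner_zero_left, inner_zero_right, add_zero] at h
    exact h.symm
  have hD : D = star C := by
    ext1 x
    refine ext_inner_right ℝ fun y => ?_
    rw [inner_star_apply]
    have h := hPsymm (0, x) (y, 0)
    simp only [inner_zero_left, inner_zero_right, add_zero, zero_add] at h
    exact h
  have hCZ : ∀ u, Z u ∈ T.dom ∧ C u = T.app (Z u) ∧ C u ∈ S.dom ∧ S.app (C u) = u - Z u := by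
    intro u
    have h1 := hPG (u, 0)
    have h2 := hS.mem_and_app_eq hlin hdense (a := u - Z u) (y := C u) fun x hx => by
      have h := hPorth (u, 0) x hx
      change ⟪u - Z u, x⟫_ℝ + ⟪0 - C u, T.app x⟫_ℝ = 0 at h
      rw [zero_sub, inner_neg_left] at h
      linarith
    exact ⟨h1.1, h1.2, h2⟩
  have huniq : ∀ u z, z ∈ T.dom → T.app z ∈ S.dom → S.app (T.app z) = u - z → z = Z u := by
    intro u z hz hTz h
    obtain ⟨h1, h2, h3, h4⟩ := hCZ u
    rw [h2] at h3 h4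
    exact hS.eq_of_add_eq hlin hz hTz h1 h3 (by rw [h, h4]; abel)
  have hF : F = 1 - Z := by
    ext1 w
    have h1 := hPG (0, w)
    change D w ∈ T.dom ∧ F w = T.app (D w) at h1
    have h2 := hS.mem_and_app_eq hlin hdense (a := D w) (y := w - F w) fun x hx => by
      have h := hPorth (0, w) x hx
      change ⟪0 - D w, x⟫_ℝ + ⟪w - F w, T.app x⟫_ℝ = 0 at h
      rw [zero_sub, inner_neg_left] at h
      linarith
    have h3 : w - F w ∈ (S.comp T).dom := by
      rw [hdom]
      refine ⟨h2.1, ?_⟩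
      rw [h2.2]
      exact h1.1
    have h4 : S.app (T.app (w - F w)) = T.app (S.app (w - F w)) := happ _ h3
    rw [h2.2, ← h1.2] at h4
    have h5 := huniq w (w - F w) h3.1 h3.2 (by rw [h4]; abel)
    change F w = w - Z w
    rw [← h5]; abel
  have hPP : ∀ p, P (P p) = P p := fun p => by
    have h := hPself _ (hPG p).1
    rwa [← (hPG p).2] at h
  have hP1 : ∀ u, Z (C u) = C (Z u) := fun u => by
    have h := congrArg Prod.snd (hPP (u, 0))
    rw [hPadd u 0, hPadd] at h
    simp only [map_zero, add_zero, hF] at h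
    change C (Z u) + (C u - Z (C u)) = C u at h
    rw [← sub_eq_zero] at h ⊢
    rw [← neg_eq_zero, ← h]; abel
  have hP2 : ∀ u, D (C u) = Z u - Z (Z u) := fun u => by
    have h := congrArg Prod.fst (hPP (u, 0))
    rw [hPadd u 0, hPadd] at h
    simp only [map_zero, add_zero] at h
    exact eq_sub_of_add_eq' h
  have hP3 : ∀ w, C (D w) = Z w - Z (Z w) := fun w => by
    have h := congrArg Prod.snd (hPP (0, w))
    rw [hPadd 0 w, hPadd] at h
    simp only [map_zero, zero_add, hF] at h
    change C (D w) + ((w - Z w) - Z (w - Z w)) = w - Z w at h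
    rw [map_sub] at h
    rw [← sub_eq_zero] at h ⊢
    rw [← h]; abel
  have hZq : ∀ q u, Z (rsmul q u) = rsmul q (Z u) := fun q u => by
    obtain ⟨h1, h2, h3, h4⟩ := hCZ u
    obtain ⟨h5, h6⟩ := hlin.2.2 _ h1 q
    obtain ⟨h7, h8⟩ := hS.app_rsmul hlin hdense h3 q
    rw [h2, ← h6] at h7 h8
    refine (huniq _ _ h5 h7 ?_).symm
    rw [h8, ← h2, h4]
    exact map_sub (rightMul q) u (Z u)
  refine ⟨Z, C, hZ, ?_, ?_, fun q => ?_, fun q => ?_, fun u w => ?_, fun x hx => ?_⟩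
  · ext1 u
    exact hP1 u
  · rw [← hD]
    ext1 u
    exact (hP3 u).trans (hP2 u).symm
  · ext1 u
    exact hZq q u
  · ext1 u
    change C (rsmul q u) = rsmul q (C u)
    rw [(hCZ _).2.1, (hCZ u).2.1, hZq, (hlin.2.2 _ (hCZ u).1 q).2]
  · have h := hPG (u, w)
    rw [hPadd, hF, hD] at h
    exact ⟨h.1, h.2.symm⟩
  · have h := hPself x hx
    rw [hPadd, hF, hD, Prod.mk.injEq] at h
    refine ⟨h.1, ?_⟩
    have h2 : C x + (T.app x - Z (T.app x)) = T.app x := h.2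
    rw [← sub_eq_zero] at h2 ⊢
    rw [← h2]; abel

end

/-- For every densely defined closed right linear normal operator `T`
in `H = ℓ²(ℕ, ℍ)` there is an anti self-adjoint unitary `J ∈ B(H)` with `JT ⊆ TJ`. -/
theorem exists_antiSelfAdjoint_unitary_commuting (T : QOp)
    (hlin : T.IsRightLinear) (hdense : T.IsDenselyDefined)
    (hclosed : T.IsClosedOp) (hnormal : T.IsNormal) :
    ∃ J : Hsp → Hsp, IsBoundedRightLinear J ∧ IsAntiSelfAdjoint J ∧ IsUnitaryOp J ∧
      (∀ x ∈ T.dom, J x ∈ T.dom) ∧ (∀ x ∈ T.dom, J (T.app x) = T.app (J x)) := by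
  obtain ⟨Z, C, hZ, hZC, hCC, hZq, hCq, hgraph, hself⟩ :=
    hnormal.exists_graph_projection hlin hdense hclosed
  have hZC' : Commute Z (star C) := by
    have h := hZC.star_star
    rwa [hZ] at h
  let A := StarAlgebra.adjoin ℝ {Z, C}
  have hZA : Z ∈ A := StarAlgebra.subset_adjoin ℝ _ (by simp)
  have hCA : C ∈ A := StarAlgebra.subset_adjoin ℝ _ (by simp)
  have hA : IsMulCommutative A := by
    refine StarAlgebra.isMulCommutative_adjoin ℝ ?_ ?_
    · rintro a (rfl | rfl) b (rfl | rfl)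
      exacts [rfl, hZC.eq, hZC.symm.eq, rfl]
    · rintro a (rfl | rfl) b (rfl | rfl)
      · rw [hZ]
      · exact hZC'.eq
      · rw [hZ]; exact hZC.symm.eq
      · exact hCC.eq
  have hAq : ∀ q, ∀ a ∈ A, Commute a (rightMul q) := by
    intro q
    have h : A ≤ StarSubalgebra.centralizer ℝ {rightMul q} := by
      refine StarAlgebra.adjoin_le ?_
      rintro a (rfl | rfl) <;> rw [SetLike.mem_coe, StarSubalgebra.mem_centralizer_iff] <;>
        rintro _ rfl <;> rw [star_rightMul]
      exacts [⟨(hZq q).symm.eq, (hZq _).symm.eq⟩, ⟨(hCq q).symm.eq, (hCq _).symm.eq⟩]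
    intro a ha
    exact ((StarSubalgebra.mem_centralizer_iff ℝ).1 (h ha) _ rfl).1.symm
  have hskew : ∀ q : Hq, star q = -q → star (rightMul q) = -rightMul q := fun q hq => by
    rw [star_rightMul, hq, ← neg_one_mul q, ← rightMul_mul, ← Quaternion.coe_one,
      ← Quaternion.coe_neg, rightMul_coe]
    simp
  have hneg : ∀ p q : Hq, q * p = -1 → rightMul p * rightMul q = -1 := fun p q h => by
    rw [rightMul_mul, h, ← Quaternion.coe_one, ← Quaternion.coe_neg, rightMul_coe]
    simp
  obtain ⟨J, hJs, hJJ, hJi, hJj, hJA⟩ := exists_skew_unitary_commuting A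
    (fun a ha b hb => congrArg Subtype.val (hA.is_comm.comm ⟨a, ha⟩ ⟨b, hb⟩))
    (hskew unitI (by ext <;> simp)) (hskew unitJ (by ext <;> simp))
    (hneg _ _ (by ext <;> simp)) (hneg _ _ (by ext <;> simp))
    (by
      have h : unitJ * unitI = ((-1 : ℝ) : Hq) * (unitI * unitJ) := by ext <;> simp
      rw [rightMul_mul, rightMul_mul, h, ← rightMul_mul, rightMul_coe]
      simp)
    (hAq _) (hAq _)
  have hJq : ∀ q x, J (rsmul q x) = rsmul q (J x) := fun q x =>
    congrArg (· x) (commute_rightMul hJi hJj q).eq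
  have hJa : ∀ a ∈ A, ∀ x, J (a x) = a (J x) := fun a ha x => congrArg (· x) (hJA a ha).eq
  have hJJx : ∀ x, J (J x) = -x := fun x => congrArg (· x) hJJ
  have hadj : IsAntiSelfAdjoint J := fun x y => qinner_eq_of_inner_rsmul fun q => by
    rw [← hJq, real_inner_comm, inner_apply_of_star_eq_neg hJs, real_inner_comm, inner_neg_left]
  have hmain : ∀ x ∈ T.dom, J x ∈ T.dom ∧ J (T.app x) = T.app (J x) := by
    intro x hx
    obtain ⟨h1, h2⟩ := hself x hx
    obtain ⟨h3, h4⟩ := hgraph (J x) (J (T.app x))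
    have h5 : Z (J x) + star C (J (T.app x)) = J x := by
      rw [← hJa Z hZA, ← hJa _ (star_mem hCA), ← map_add, h1]
    rw [h5] at h3 h4
    refine ⟨h3, ?_⟩
    rw [h4, ← hJa C hCA, ← hJa Z hZA, h2]
    abel
  refine ⟨J, ⟨map_add J, hJq, ‖J‖, J.le_opNorm⟩, hadj, ⟨_, hadj, fun x => ?_, fun x => ?_⟩,
    fun x hx => (hmain x hx).1, fun x hx => (hmain x hx).2⟩
  · rw [hJJx, neg_neg]
  · rw [map_neg, hJJx, neg_neg]
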